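/- If a group Γ is generated by a finite set of elements of finite order, then whenever the wreath product Γ ≀ C_d (with C_d cyclic of order d) acts by isometries on a complete CAT(0) space of topological dimension less than d, it has a global fixed point. -/

import Mathlib

/-- A geodesic segment from `x` to `y`, parameterized proportionally to arc length on `[0,1]`. -/
def IsGeodesicSeg {X : Type*} [MetricSpace X] (x y : X) (γ : ℝ → X) : Prop :=
  γ 0 = x ∧ γ 1 = y ∧
    ∀ s ∈ Set.Icc (0:ℝ) 1, ∀ t ∈ Set.Icc (0:ℝ) 1, dist (γ s) (γ t) = |s - t| * dist x y

/-- A CAT(0) space: a geodesic metric space satisfying the CN (Bruhat–Tits comparison)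
inequality, which for geodesic spaces is equivalent to the CAT(0) comparison-triangle
condition. -/
class CAT0Space (X : Type*) [MetricSpace X] : Prop where
  geodesic : ∀ x y : X, ∃ γ : ℝ → X, IsGeodesicSeg x y γ
  cn : ∀ x y z m : X, dist y m = dist y z / 2 → dist z m = dist y z / 2 →
    dist x m ^ 2 ≤ (dist x y ^ 2 + dist x z ^ 2) / 2 - dist y z ^ 2 / 4

/-- Topological covering dimension of `X` is at most `d`: every open cover has an open
refinement in which each point lies in at most `d + 1` sets. -/
def CoveringDimLE (X : Type*) [TopologicalSpace X] (d : ℕ) : Prop :=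
  ∀ (ι : Type) (U : ι → Set X), (∀ i, IsOpen (U i)) → (⋃ i, U i) = Set.univ →
    ∃ (κ : Type) (V : κ → Set X), (∀ j, IsOpen (V j)) ∧ (⋃ j, V j) = Set.univ ∧
      (∀ j, ∃ i, V j ⊆ U i) ∧
      ∀ x : X, {j | x ∈ V j}.Finite ∧ {j | x ∈ V j}.ncard ≤ d + 1

/-- The shift action of the cyclic group C_d = ZMod d on the direct product of d copies
of Γ, permuting the coordinates. -/
def shiftHom (Γ : Type) [Group Γ] (d : ℕ) :
    Multiplicative (ZMod d) →* MulAut (ZMod d → Γ) where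
  toFun t :=
    { toFun := fun f s => f (s - Multiplicative.toAdd t)
      invFun := fun f s => f (s + Multiplicative.toAdd t)
      left_inv := fun f => funext fun s => by simp
      right_inv := fun f => funext fun s => by simp
      map_mul' := fun f g => rfl }
  map_one' := by
    ext f s
    simp
  map_mul' a b := by
    ext f s
    simp [sub_sub]

/-- The wreath product Γ ≀ C_d of Γ with the cyclic group of order d; since C_d is finite,
the restricted and unrestricted wreath products coincide. -/
def WreathCd (Γ : Type) [Group Γ] (d : ℕ) : Type :=
  (ZMod d → Γ) ⋊[shiftHom Γ d] Multiplicative (ZMod d)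

instance (Γ : Type) [Group Γ] (d : ℕ) : Group (WreathCd Γ d) :=
  inferInstanceAs (Group ((ZMod d → Γ) ⋊[shiftHom Γ d] Multiplicative (ZMod d)))


open Finset in
/-- `k`-th vertex of the Kuhn simplex with base `a` and order `σ`. -/
def kuhnPath {d : ℕ} (a : Fin d → ℕ) (σ : Equiv.Perm (Fin d)) (k : ℕ) : Fin d → ℕ :=
  fun i => a i + if (σ i : ℕ) < k then 1 else 0

/-- all labels `0..n` occur among `f 0, …, f n` -/
def KFull (n : ℕ) (f : Fin (n+1) → ℕ) : Prop := ∀ m ≤ n, ∃ k, f k = m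

/-- all labels `1..n` occur among the values of `f`. -/
def KDoor (n : ℕ) (f : Fin n → ℕ) : Prop := ∀ m, 1 ≤ m → m ≤ n → ∃ k, f k = m

open Classical in
lemma kuhn_local (n : ℕ) (f : Fin (n+1) → ℕ) (hf : ∀ k, f k ≤ n) :
    (if KFull n f then (1 : ZMod 2) else 0) =
      ∑ i : Fin (n+1), if KDoor n (fun k => f (i.succAbove k)) then (1 : ZMod 2) else 0 := by
  have doorinj : ∀ i : Fin (n+1), KDoor n (fun k => f (i.succAbove k)) →
      Function.Injective (fun k => f (i.succAbove k)) ∧ ∀ k, 1 ≤ f (i.succAbove k) := by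
    intro i hd
    have hcard : Finset.Icc 1 n ⊆ Finset.univ.image (fun k : Fin n => f (i.succAbove k)) := by
      intro m hm
      rw [Finset.mem_Icc] at hm
      obtain ⟨k, hk⟩ := hd m hm.1 hm.2
      exact Finset.mem_image.2 ⟨k, Finset.mem_univ _, hk⟩
    have heq := Finset.eq_of_subset_of_card_le hcard (by
      refine Finset.card_image_le.trans ?_
      simp)
    constructor
    · have : (Finset.univ.image (fun k : Fin n => f (i.succAbove k))).card = (Finset.univ : Finset (Fin n)).card := by
        rw [← heq]; simp
      have h2 := Finset.card_image_iff.1 this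
      intro x y hxy
      exact h2 (by simp) (by simp) hxy
    · intro k
      have : f (i.succAbove k) ∈ Finset.Icc 1 n := by
        rw [heq]; exact Finset.mem_image.2 ⟨k, Finset.mem_univ _, rfl⟩
      exact (Finset.mem_Icc.1 this).1
  by_cases hfull : KFull n f
  · rw [if_pos hfull]
    obtain ⟨i0, hi0⟩ := hfull 0 (Nat.zero_le _)
    rw [Finset.sum_eq_single i0]
    · rw [if_pos]
      intro m h1 hm
      obtain ⟨k, hk⟩ := hfull m hm
      have : k ≠ i0 := by rintro rfl; omega
      obtain ⟨z, hz⟩ := Fin.exists_succAbove_eq this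
      exact ⟨z, by simp only [hz, hk]⟩
    · intro i _ hne
      rw [if_neg]
      intro hd
      obtain ⟨z, hz⟩ := Fin.exists_succAbove_eq hne.symm
      have := (doorinj i hd).2 z
      rw [hz] at this; omega
    · simp
  · rw [if_neg hfull]
    by_cases hex : ∃ i : Fin (n+1), KDoor n (fun k => f (i.succAbove k))
    · obtain ⟨i, hd⟩ := hex
      have hfi : 1 ≤ f i := by
        by_contra h0
        apply hfull
        intro m hm
        rcases Nat.eq_zero_or_pos m with rfl | hpos
        · exact ⟨i, by omega⟩
        · obtain ⟨k, hk⟩ := hd m hpos hm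
          exact ⟨_, hk⟩
      obtain ⟨z, hz⟩ := hd (f i) hfi (hf i)
      simp only at hz
      have hij : i ≠ i.succAbove z := (Fin.succAbove_ne i z).symm
      set j := i.succAbove z with hj
      rw [← Finset.sum_subset (Finset.subset_univ {i, j}), Finset.sum_pair hij, if_pos hd, if_pos]
      · decide
      · intro m h1 hm
        obtain ⟨k, hk⟩ := hd m h1 hm
        simp only at hk
        by_cases hkj : i.succAbove k = j
        · obtain ⟨w, hw⟩ := Fin.exists_succAbove_eq hij
          refine ⟨w, ?_⟩
          simp only [hw]
          rw [← hk, hkj, hz]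
        · obtain ⟨w, hw⟩ := Fin.exists_succAbove_eq hkj
          exact ⟨w, by simp only [hw, hk]⟩
      · intro l _ hl
        rw [if_neg]
        intro hdl
        simp only [Finset.mem_insert, Finset.mem_singleton, not_or] at hl
        obtain ⟨p, hp⟩ := Fin.exists_succAbove_eq (Ne.symm hl.1)
        obtain ⟨q, hq⟩ := Fin.exists_succAbove_eq (Ne.symm hl.2)
        have := (doorinj l hdl).1 (a₁ := p) (a₂ := q) (by simp only [hp, hq, hz])
        rw [this, hq] at hp
        exact hij hp.symm
    · push Not at hex
      rw [Finset.sum_eq_zero]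
      intro i _
      rw [if_neg (hex i)]

lemma kuhn_middle {d : ℕ} (a : Fin d → ℕ) (i : ℕ) (h0 : 0 < i) (hi : i < d)
    (φ : (ℕ → Fin d → ℕ) → ZMod 2) (hφ : ∀ p q, (∀ k, k ≠ i → p k = q k) → φ p = φ q) :
    ∑ σ : Equiv.Perm (Fin d), φ (kuhnPath a σ) = 0 := by
  let x : Fin d := ⟨i - 1, by omega⟩
  let y : Fin d := ⟨i, hi⟩
  have hxy : x ≠ y := by simp [x, y, Fin.ext_iff]; omega
  refine Finset.sum_involution (fun σ _ => Equiv.swap x y * σ) ?_ ?_ ?_ ?_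
  · intro σ _
    have : φ (kuhnPath a (Equiv.swap x y * σ)) = φ (kuhnPath a σ) := by
      apply hφ
      intro k hk
      funext l
      simp only [kuhnPath, Equiv.Perm.mul_apply]
      congr 1
      have : ((Equiv.swap x y (σ l) : Fin d) : ℕ) < k ↔ (σ l : ℕ) < k := by
        rcases eq_or_ne (σ l) x with h | h
        · rw [h, Equiv.swap_apply_left]; simp only [x, y]; omega
        · rcases eq_or_ne (σ l) y with h' | h'
          · rw [h', Equiv.swap_apply_right]; simp only [x, y]; omega
          · rw [Equiv.swap_apply_of_ne_of_ne h h']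
      simp only [this]
    rw [this]
    exact CharTwo.add_self_eq_zero _
  · intro σ _ _ h
    have := congrArg (fun τ => τ * σ⁻¹) h
    simp [mul_assoc] at this
    exact hxy this
  · simp
  · intro σ _; simp [← mul_assoc]

lemma kuhn_telescope {d N : ℕ} (j : Fin d) (G : (Fin d → ℕ) → ZMod 2)
    (hN : ∀ b, (∀ i, i ≠ j → b i < N) → b j = N → G b = 0) :
    ∑ a ∈ Fintype.piFinset (fun _ : Fin d => Finset.range N),
      (G (a + Pi.single j 1) + G a) =
    ∑ a ∈ (Fintype.piFinset (fun _ : Fin d => Finset.range N)).filter (fun a => a j = 0), G a := by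
  set B := Fintype.piFinset (fun _ : Fin d => Finset.range N) with hB
  have memB : ∀ a, a ∈ B ↔ ∀ i, a i < N := by intro a; simp [hB]
  rw [Finset.sum_add_distrib]
  have h1 : ∑ a ∈ B, G (a + Pi.single j 1) = ∑ a ∈ B.filter (fun a => a j ≠ 0), G a := by
    rw [← Finset.sum_filter_add_sum_filter_not B (fun a => a j + 1 < N)]
    rw [Finset.sum_eq_zero (s := B.filter (fun a => ¬ (a j + 1 < N))), add_zero]
    · refine Finset.sum_bij' (fun a _ => a + Pi.single j 1) (fun a _ => a - Pi.single j 1) ?_ ?_ ?_ ?_ ?_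
      · intro a ha
        rw [Finset.mem_filter, memB] at ha ⊢
        refine ⟨fun i => ?_, by simp⟩
        rcases eq_or_ne i j with rfl | h
        · simpa using ha.2
        · simpa [h] using ha.1 i
      · intro a ha
        rw [Finset.mem_filter, memB] at ha ⊢
        have := ha.1 j
        refine ⟨fun i => ?_, by have := ha.2; simp; omega⟩
        have := ha.1 i
        simp only [Pi.sub_apply]; omega
      · intro a ha; simp
      · intro a ha
        rw [Finset.mem_filter] at ha
        funext i
        rcases eq_or_ne i j with rfl | h
        · have := ha.2; simp; omega
        · simp [h]
      · intro a ha; rfl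
    · intro a ha
      rw [Finset.mem_filter, memB] at ha
      have hj := ha.1 j
      apply hN
      · intro i h
        have := ha.1 i; simp [h]; omega
      · simp; omega
  rw [h1, ← Finset.sum_filter_add_sum_filter_not B (fun a => a j ≠ 0) G]
  rw [← add_assoc, CharTwo.add_self_eq_zero, zero_add]
  simp

open Classical in
/-- number of full Kuhn simplices mod 2 -/
noncomputable def kuhnCount (d N : ℕ) (L : (Fin d → ℕ) → ℕ) : ZMod 2 :=
  ∑ a ∈ Fintype.piFinset (fun _ : Fin d => Finset.range N), ∑ σ : Equiv.Perm (Fin d),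
    if KFull d (fun k => L (kuhnPath a σ k)) then 1 else 0

lemma kuhnPath_le {d N : ℕ} {a : Fin d → ℕ} (ha : ∀ i, a i < N) (σ : Equiv.Perm (Fin d)) (k : ℕ)
    (i : Fin d) : kuhnPath a σ k i ≤ N := by
  have := ha i
  simp only [kuhnPath]; split_ifs <;> omega

lemma kuhnPath_rot {n : ℕ} (a : Fin (n+1) → ℕ) (σ : Equiv.Perm (Fin (n+1))) (k : ℕ) (hk : k ≤ n) :
    kuhnPath a (finRotate (n+1) * σ) (k+1) = kuhnPath (a + Pi.single (σ⁻¹ (Fin.last n)) 1) σ k := by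
  funext i
  simp only [kuhnPath, Pi.add_apply]
  have hm : (finRotate (n+1) * σ) i = finRotate (n+1) (σ i) := rfl
  rcases eq_or_ne (σ i) (Fin.last n) with h | h
  · have hi : σ⁻¹ (Fin.last n) = i := by rw [← h]; simp
    have h1 : ((finRotate (n+1) * σ) i : ℕ) < k + 1 := by rw [hm, h, finRotate_last]; simp
    have h2 : ¬ ((σ i : ℕ) < k) := by rw [h]; simp; omega
    rw [if_pos h1, if_neg h2, hi]; simp
  · have hi : i ≠ σ⁻¹ (Fin.last n) := by
      intro hh; apply h; rw [hh]; simp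
    have h1 : ((finRotate (n+1) * σ) i : ℕ) < k + 1 ↔ (σ i : ℕ) < k := by
      rw [hm, coe_finRotate_of_ne_last h]; omega
    simp only [h1, Pi.single_eq_of_ne hi, add_zero]

theorem kuhn_count_odd (d N : ℕ) (hN : 0 < N) (L : (Fin d → ℕ) → ℕ)
    (hle : ∀ v, (∀ i, v i ≤ N) → L v ≤ d)
    (h1 : ∀ v, (∀ i, v i ≤ N) → ∀ i : Fin d, v i = N → L v ≠ (i : ℕ) + 1)
    (h0 : ∀ v, (∀ i, v i ≤ N) → ∀ i : Fin d, v i = 0 → (i : ℕ) + 1 ≤ L v) :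
    kuhnCount d N L = 1 := by
  classical
  induction d with
  | zero =>
    have : ∀ v, L v = 0 := fun v => Nat.le_zero.1 (hle v (fun i => i.elim0))
    simp [kuhnCount, KFull, this]
  | succ n ih =>
    set B := Fintype.piFinset (fun _ : Fin (n+1) => Finset.range N) with hB
    have memB : ∀ a, a ∈ B ↔ ∀ i, a i < N := by intro a; simp [hB]
    let D : (ℕ → Fin (n+1) → ℕ) → Fin (n+2) → ZMod 2 := fun p i =>
      if KDoor (n+1) (fun k => L (p (i.succAbove k))) then 1 else 0
    let G : Equiv.Perm (Fin (n+1)) → (Fin (n+1) → ℕ) → ZMod 2 := fun σ a =>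
      D (kuhnPath a σ) (Fin.last _)
    have e1 : kuhnCount (n+1) N L = ∑ a ∈ B, ∑ σ, ∑ i, D (kuhnPath a σ) i := by
      unfold kuhnCount
      refine Finset.sum_congr rfl fun a ha => Finset.sum_congr rfl fun σ _ => ?_
      rw [memB] at ha
      exact kuhn_local (n+1) (fun k => L (kuhnPath a σ k)) (fun k => hle _ (kuhnPath_le ha σ k))
    have e2 : ∀ a, ∑ σ, ∑ i, D (kuhnPath a σ) i =
        ∑ σ, (G σ (a + Pi.single (σ⁻¹ (Fin.last n)) 1) + G σ a) := by
      intro a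
      rw [Finset.sum_comm, Fin.sum_univ_succ, Fin.sum_univ_castSucc, Finset.sum_add_distrib]
      rw [Finset.sum_eq_zero (f := fun i : Fin n => ∑ σ, D (kuhnPath a σ) i.castSucc.succ), zero_add]
      · congr 1
        rw [← Equiv.sum_comp (Equiv.mulLeft (finRotate (n+1)))]
        refine Finset.sum_congr rfl fun σ _ => ?_
        simp only [G, D, Equiv.coe_mulLeft]
        have : ∀ k : Fin (n+1), kuhnPath a (finRotate (n+1) * σ) ((Fin.succAbove 0 k : Fin (n+2)) : ℕ)
            = kuhnPath (a + Pi.single (σ⁻¹ (Fin.last n)) 1) σ ((Fin.succAbove (Fin.last (n+1)) k : Fin (n+2)) : ℕ) := by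
          intro k
          have := kuhnPath_rot a σ k (by omega)
          simpa using this
        simp only [this]
      · intro i _
        refine kuhn_middle a (i+1) (by omega) (by omega) (fun p => D p i.castSucc.succ) ?_
        intro p q hpq
        simp only [D]
        have : ∀ k : Fin (n+1), p ((i.castSucc.succ : Fin (n+2)).succAbove k) = q ((i.castSucc.succ : Fin (n+2)).succAbove k) := by
          intro k
          apply hpq
          intro h
          exact Fin.succAbove_ne (i.castSucc.succ : Fin (n+2)) k (Fin.ext (by simpa using h))
        simp only [this]
    have coordj : ∀ (σ : Equiv.Perm (Fin (n+1))) a (k : Fin (n+1)),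
        kuhnPath a σ k (σ⁻¹ (Fin.last n)) = a (σ⁻¹ (Fin.last n)) := by
      intro σ a k
      simp [kuhnPath]; omega
    have e3 : ∀ σ : Equiv.Perm (Fin (n+1)), ∑ a ∈ B, (G σ (a + Pi.single (σ⁻¹ (Fin.last n)) 1) + G σ a)
        = ∑ a ∈ B.filter (fun a => a (σ⁻¹ (Fin.last n)) = 0), G σ a := by
      intro σ
      refine kuhn_telescope (σ⁻¹ (Fin.last n)) (G σ) ?_
      intro b hb hbj
      simp only [G, D]
      rw [if_neg]
      intro hd
      obtain ⟨k, hk⟩ := hd ((σ⁻¹ (Fin.last n) : Fin (n+1)) + 1) (by omega) (by omega)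
      rw [Fin.succAbove_last] at hk
      simp only [Fin.val_castSucc] at hk
      refine h1 _ (fun i => ?_) _ ((coordj σ b k).trans hbj) hk
      rcases eq_or_ne i (σ⁻¹ (Fin.last n)) with h | h
      · rw [h, coordj, hbj]
      · have := hb i h
        simp only [kuhnPath]; split_ifs <;> omega
    let S : Fin (n+1) × Equiv.Perm (Fin n) → Equiv.Perm (Fin (n+1)) := fun q =>
      (finRotate (n+1))⁻¹ * Equiv.Perm.decomposeFin.symm q
    let E : Fin (n+1) × Equiv.Perm (Fin n) ≃ Equiv.Perm (Fin (n+1)) :=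
      Equiv.Perm.decomposeFin.symm.trans (Equiv.mulLeft (finRotate (n+1))⁻¹)
    have hES : ∀ q, E q = S q := fun q => rfl
    have hrot0 : (finRotate (n+1))⁻¹ 0 = Fin.last n := by
      rw [Equiv.Perm.inv_eq_iff_eq, finRotate_last]
    have hrots : ∀ x : Fin n, (finRotate (n+1))⁻¹ x.succ = x.castSucc := by
      intro x
      rw [Equiv.Perm.inv_eq_iff_eq]
      ext
      rw [coe_finRotate_of_ne_last (Fin.castSucc_lt_last x).ne]; simp
    have hS0 : ∀ e, S (0, e) 0 = Fin.last n := by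
      intro e
      have : S (0, e) 0 = (finRotate (n+1))⁻¹ (Equiv.Perm.decomposeFin.symm (0, e) 0) := rfl
      rw [this, Equiv.Perm.decomposeFin_symm_apply_zero, hrot0]
    have hSs : ∀ e x, S (0, e) (Fin.succ x) = (e x).castSucc := by
      intro e x
      have : S (0, e) x.succ = (finRotate (n+1))⁻¹ (Equiv.Perm.decomposeFin.symm (0, e) x.succ) := rfl
      rw [this, Equiv.Perm.decomposeFin_symm_apply_succ, Equiv.swap_self, Equiv.refl_apply, hrots]
    have hSp : ∀ p e, p ≠ 0 → (S (p, e))⁻¹ (Fin.last n) ≠ 0 := by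
      intro p e hp h
      rw [Equiv.Perm.inv_eq_iff_eq] at h
      apply hp
      have : (finRotate (n+1))⁻¹ p = Fin.last n := by
        rw [h]; simp [S]
      rw [Equiv.Perm.inv_eq_iff_eq, finRotate_last] at this
      exact this
    have hpath : ∀ (b : Fin n → ℕ) e (k : ℕ), k ≤ n →
        kuhnPath (Fin.cons 0 b : Fin (n+1) → ℕ) (S (0, e)) k = Fin.cons 0 (kuhnPath b e k) := by
      intro b e k hk
      funext i
      refine Fin.cases ?_ (fun x => ?_) i
      · simp [kuhnPath, hS0]; omega
      · simp [kuhnPath, hSs]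
    have consle : ∀ v : Fin n → ℕ, (∀ i, v i ≤ N) → ∀ i, (Fin.cons 0 v : Fin (n+1) → ℕ) i ≤ N := by
      intro v hv i
      refine Fin.cases ?_ (fun x => ?_) i
      · simp
      · simpa using hv x
    rw [e1, Finset.sum_congr rfl (fun a _ => e2 a), Finset.sum_comm,
      Finset.sum_congr rfl (fun σ _ => e3 σ), ← Equiv.sum_comp E, Fintype.sum_prod_type,
      Finset.sum_eq_single 0]
    · rw [← ih (fun v => L (Fin.cons 0 v) - 1)]
      · unfold kuhnCount
        rw [Finset.sum_comm]
        refine Finset.sum_congr rfl fun e _ => ?_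
        have hinv : (E (0, e))⁻¹ (Fin.last n) = 0 := by
          rw [Equiv.Perm.inv_eq_iff_eq, hES, hS0]
        rw [hinv]
        refine Finset.sum_bij' (fun a _ => Fin.tail a) (fun b _ => Fin.cons 0 b) ?_ ?_ ?_ ?_ ?_
        · intro a ha
          rw [Finset.mem_filter, memB] at ha
          simp [Fin.tail, ha.1]
        · intro b hb
          rw [Finset.mem_filter, memB]
          simp only [Fintype.mem_piFinset, Finset.mem_range] at hb
          refine ⟨fun i => ?_, by simp⟩
          refine Fin.cases ?_ (fun x => ?_) i
          · simpa using hN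
          · simpa using hb x
        · intro a ha
          rw [Finset.mem_filter] at ha
          rw [← ha.2]; exact Fin.cons_self_tail a
        · intro b hb; simp
        · intro a ha
          rw [Finset.mem_filter, memB] at ha
          have hacons : a = Fin.cons 0 (Fin.tail a) := by
            conv_rhs => rw [← ha.2]
            exact (Fin.cons_self_tail a).symm
          simp only [G, D]
          congr 1
          rw [eq_iff_iff]
          have hp : ∀ k : Fin (n+1), L (kuhnPath a (E (0, e)) ((Fin.last (n+1)).succAbove k : Fin (n+2)))
              = L (Fin.cons 0 (kuhnPath (Fin.tail a) e k)) := by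
            intro k
            rw [Fin.succAbove_last, hES, hacons]
            simp only [Fin.val_castSucc, Fin.tail_cons]
            rw [hpath _ _ _ (by omega)]
          have hpos : ∀ k : Fin (n+1), 1 ≤ L (Fin.cons 0 (kuhnPath (Fin.tail a) e k)) := by
            intro k
            have := h0 (Fin.cons 0 (kuhnPath (Fin.tail a) e k))
              (consle _ (kuhnPath_le (fun i => ha.1 i.succ) e k)) 0 (by simp)
            simpa using this
          constructor
          · intro hd m hm
            obtain ⟨k, hk⟩ := hd (m+1) (by omega) (by omega)
            refine ⟨k, ?_⟩
            simp only [hp] at hk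
            simp only [hk]; omega
          · intro hd m h1m hm
            obtain ⟨k, hk⟩ := hd (m-1) (by omega)
            refine ⟨k, ?_⟩
            simp only [hp]
            have := hpos k
            simp only at hk
            omega
      · intro v hv
        have := hle _ (consle v hv)
        omega
      · intro v hv i hi
        have := h1 _ (consle v hv) i.succ (by simpa using hi)
        simp at this
        omega
      · intro v hv i hi
        have := h0 _ (consle v hv) i.succ (by simpa using hi)
        simp at this
        omega
    · intro p _ hp
      refine Finset.sum_eq_zero fun e _ => Finset.sum_eq_zero fun a ha => ?_
      rw [Finset.mem_filter, memB] at ha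
      simp only [G, D]
      rw [if_neg]
      intro hd
      obtain ⟨k, hk⟩ := hd 1 le_rfl (by omega)
      rw [Fin.succAbove_last] at hk
      simp only [Fin.val_castSucc] at hk
      have := h0 _ (kuhnPath_le ha.1 (E (p, e)) k) _ ((coordj _ a k).trans ha.2)
      have hne := hSp p e hp
      rw [hk] at this
      apply hne
      ext
      rw [hES] at this
      simp only [Fin.val_zero]; omega
    · simp

section cat0
variable {X : Type*} [MetricSpace X]

lemma IsGeodesicSeg.continuousOn {x y : X} {γ : ℝ → X} (h : IsGeodesicSeg x y γ) :
    ContinuousOn γ (Set.Icc 0 1) := by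
  have : LipschitzOnWith (Real.toNNReal (dist x y)) γ (Set.Icc 0 1) := by
    refine LipschitzOnWith.of_dist_le_mul fun s hs t ht => ?_
    rw [h.2.2 s hs t ht, Real.coe_toNNReal _ dist_nonneg, Real.dist_eq, mul_comm]
  exact this.continuousOn

variable [CAT0Space X]

/-- Stewart inequality -/
lemma cat0_stewart {x y : X} {γ : ℝ → X} (h : IsGeodesicSeg x y γ) (z : X) {t : ℝ}
    (ht : t ∈ Set.Icc (0:ℝ) 1) :
    dist z (γ t) ^ 2 ≤ (1 - t) * dist z x ^ 2 + t * dist z y ^ 2 - t * (1 - t) * dist x y ^ 2 := by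
  set D := dist x y with hD
  let F : ℝ → ℝ := fun t => dist z (γ t) ^ 2 -
    ((1 - t) * dist z x ^ 2 + t * dist z y ^ 2 - t * (1 - t) * D ^ 2)
  have hF : ContinuousOn F (Set.Icc 0 1) := by
    have := h.continuousOn
    refine ContinuousOn.sub ?_ (Continuous.continuousOn (by fun_prop))
    exact (Continuous.comp_continuousOn (g := fun w => dist z w) (by fun_prop) this).pow 2
  have hF0 : F 0 = 0 := by simp [F, h.1]
  have hF1 : F 1 = 0 := by simp [F, h.2.1]
  have hmid : ∀ s ∈ Set.Icc (0:ℝ) 1, ∀ t ∈ Set.Icc (0:ℝ) 1, F ((s + t)/2) ≤ (F s + F t) / 2 := by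
    intro s hs t ht
    have hm : (s + t)/2 ∈ Set.Icc (0:ℝ) 1 := ⟨by linarith [hs.1, ht.1], by linarith [hs.2, ht.2]⟩
    have hst := h.2.2 s hs t ht
    have := CAT0Space.cn z (γ s) (γ t) (γ ((s+t)/2))
      (by rw [h.2.2 s hs _ hm, hst, show s - (s+t)/2 = (s-t)/2 by ring, abs_div, abs_two]; ring)
      (by rw [h.2.2 t ht _ hm, hst, show t - (s+t)/2 = -((s-t)/2) by ring, abs_neg, abs_div, abs_two]; ring)
    rw [hst, mul_pow, sq_abs] at this
    simp only [F]
    nlinarith [this]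
  obtain ⟨t0, ht0, hmax⟩ := isCompact_Icc.exists_isMaxOn (Set.nonempty_Icc.2 zero_le_one) hF
  have hle : F t0 ≤ 0 := by
    have hmax' : ∀ s ∈ Set.Icc (0:ℝ) 1, F s ≤ F t0 := hmax
    rcases le_total t0 (1/2) with hh | hh
    · have := hmid 0 (by simp) (2 * t0) ⟨by linarith [ht0.1], by linarith⟩
      rw [show (0 + 2 * t0)/2 = t0 by ring, hF0] at this
      have := hmax' (2 * t0) ⟨by linarith [ht0.1], by linarith⟩
      linarith
    · have := hmid 1 (by simp) (2 * t0 - 1) ⟨by linarith, by linarith [ht0.2]⟩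
      rw [show (1 + (2 * t0 - 1))/2 = t0 by ring, hF1] at this
      have := hmax' (2 * t0 - 1) ⟨by linarith, by linarith [ht0.2]⟩
      linarith
  have : F t ≤ F t0 := hmax ht
  simp only [F] at this hle
  linarith

/-- chosen geodesic -/
noncomputable def geo (x y : X) (t : ℝ) : X :=
  Classical.choose (CAT0Space.geodesic x y) (Set.projIcc 0 1 zero_le_one t)

lemma geo_spec (x y : X) : IsGeodesicSeg x y (geo x y) := by
  have h := Classical.choose_spec (CAT0Space.geodesic x y)
  have key : ∀ t ∈ Set.Icc (0:ℝ) 1, geo x y t = Classical.choose (CAT0Space.geodesic x y) t := by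
    intro t ht
    simp only [geo]
    rw [Set.projIcc_of_mem _ ht]
  refine ⟨?_, ?_, ?_⟩
  · rw [key 0 (by simp)]; exact h.1
  · rw [key 1 (by simp)]; exact h.2.1
  · intro s hs t ht
    rw [key s hs, key t ht]; exact h.2.2 s hs t ht

lemma geo_proj (x y : X) (t : ℝ) : geo x y t = geo x y (Set.projIcc (0:ℝ) 1 zero_le_one t) := by
  simp [geo]

lemma geo_zero (x y : X) : geo x y 0 = x := (geo_spec x y).1
lemma geo_one (x y : X) : geo x y 1 = y := (geo_spec x y).2.1

lemma dist_left_geo (x y : X) {t : ℝ} (ht : t ∈ Set.Icc (0:ℝ) 1) :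
    dist x (geo x y t) = t * dist x y := by
  have := (geo_spec x y).2.2 0 (by simp) t ht
  rw [geo_zero] at this
  rw [this]; simp [abs_of_nonneg ht.1]

lemma dist_right_geo (x y : X) {t : ℝ} (ht : t ∈ Set.Icc (0:ℝ) 1) :
    dist y (geo x y t) = (1 - t) * dist x y := by
  have := (geo_spec x y).2.2 1 (by simp) t ht
  rw [geo_one] at this
  rw [this, abs_of_nonneg (by linarith [ht.2])]

lemma geo_unique {x y p : X} {t : ℝ} (ht : t ∈ Set.Icc (0:ℝ) 1) (h1 : dist x p = t * dist x y)
    (h2 : dist y p = (1 - t) * dist x y) : p = geo x y t := by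
  have := cat0_stewart (geo_spec x y) p ht
  rw [dist_comm p x, dist_comm p y, h1, h2] at this
  have h0 : dist p (geo x y t) ^ 2 ≤ 0 := by nlinarith [this]
  have := pow_eq_zero_iff (two_ne_zero) |>.1 (le_antisymm h0 (sq_nonneg _))
  exact dist_eq_zero.1 this

lemma geo_symm (x y : X) {t : ℝ} (ht : t ∈ Set.Icc (0:ℝ) 1) : geo x y t = geo y x (1 - t) := by
  refine geo_unique ⟨by linarith [ht.2], by linarith [ht.1]⟩ ?_ ?_
  · rw [dist_right_geo x y ht, dist_comm x y]
  · rw [dist_left_geo x y ht, dist_comm x y]; ring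

lemma dist_geo_right (x y y' : X) {t : ℝ} (ht : t ∈ Set.Icc (0:ℝ) 1) :
    dist (geo x y t) (geo x y' t) ≤ dist y y' := by
  have h1 := cat0_stewart (geo_spec x y) (geo x y' t) ht
  have h2 := cat0_stewart (geo_spec x y') y ht
  rw [dist_comm _ x, dist_left_geo x y' ht, dist_comm _ y] at h1
  rw [dist_comm y x] at h2
  have h3 : dist (geo x y' t) (geo x y t) ^ 2 ≤ t ^ 2 * dist y y' ^ 2 := by
    nlinarith [mul_le_mul_of_nonneg_left h2 ht.1]
  have h4 : t ^ 2 * dist y y' ^ 2 ≤ dist y y' ^ 2 := by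
    have : t ^ 2 ≤ 1 := by nlinarith [ht.1, ht.2]
    nlinarith [sq_nonneg (dist y y')]
  rw [dist_comm]
  exact le_of_sq_le_sq (h3.trans h4) dist_nonneg

lemma dist_geo_left (x x' y : X) {t : ℝ} (ht : t ∈ Set.Icc (0:ℝ) 1) :
    dist (geo x y t) (geo x' y t) ≤ dist x x' := by
  rw [geo_symm x y ht, geo_symm x' y ht]
  exact dist_geo_right _ _ _ ⟨by linarith [ht.2], by linarith [ht.1]⟩

lemma geo_continuous : Continuous (fun p : X × X × ℝ => geo p.1 p.2.1 p.2.2) := by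
  have key : ∀ (x y x' y' : X) (s t : ℝ), dist (geo x y s) (geo x' y' t) ≤
      dist x x' + dist y y' + |(Set.projIcc (0:ℝ) 1 zero_le_one s : ℝ) - (Set.projIcc (0:ℝ) 1 zero_le_one t : ℝ)| * dist x' y' := by
    intro x y x' y' s t
    rw [geo_proj x y s, geo_proj x' y' t]
    have hs := (Set.projIcc (0:ℝ) 1 zero_le_one s).2
    have ht := (Set.projIcc (0:ℝ) 1 zero_le_one t).2
    have h1 := dist_geo_left x x' y hs
    have h2 := dist_geo_right x' y y' hs
    have h3 := (geo_spec x' y').2.2 _ hs _ ht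
    have := dist_triangle4 (geo x y (Set.projIcc (0:ℝ) 1 zero_le_one s)) (geo x' y (Set.projIcc (0:ℝ) 1 zero_le_one s))
      (geo x' y' (Set.projIcc (0:ℝ) 1 zero_le_one s)) (geo x' y' (Set.projIcc (0:ℝ) 1 zero_le_one t))
    linarith
  rw [continuous_iff_continuousAt]
  rintro ⟨x', y', t⟩
  rw [ContinuousAt, tendsto_iff_dist_tendsto_zero]
  have hc : Continuous (fun p : X × X × ℝ => dist p.1 x' + dist p.2.1 y' +
      |(Set.projIcc (0:ℝ) 1 zero_le_one p.2.2 : ℝ) - (Set.projIcc (0:ℝ) 1 zero_le_one t : ℝ)| * dist x' y') := by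
    have : Continuous (fun p : X × X × ℝ => (Set.projIcc (0:ℝ) 1 zero_le_one p.2.2 : ℝ)) :=
      continuous_subtype_val.comp (continuous_projIcc.comp (by fun_prop))
    fun_prop
  have h0 := hc.tendsto (x', y', t)
  simp only [dist_self, sub_self, abs_zero, zero_mul, add_zero] at h0
  exact squeeze_zero (fun _ => dist_nonneg) (fun p => key _ _ _ _ _ _) h0

/-- geodesically convex -/
def GConv (C : Set X) : Prop := ∀ x ∈ C, ∀ y ∈ C, ∀ t, geo x y t ∈ C

lemma GConv.inter {C D : Set X} (hC : GConv C) (hD : GConv D) : GConv (C ∩ D) :=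
  fun x hx y hy t => ⟨hC x hx.1 y hy.1 t, hD x hx.2 y hy.2 t⟩

/-- map of a cube -/
lemma exists_cube_map (n : ℕ) : ∀ x : (Fin n → Bool) → X, ∃ f : (Fin n → ℝ) → X, Continuous f ∧
    (∀ C : Set X, GConv C → (∀ ε, x ε ∈ C) → ∀ t, f t ∈ C) ∧
    (∀ (i : Fin n) (C : Set X), GConv C → (∀ ε, ε i = false → x ε ∈ C) → ∀ t, t i = 0 → f t ∈ C) ∧
    (∀ (i : Fin n) (C : Set X), GConv C → (∀ ε, ε i = true → x ε ∈ C) → ∀ t, t i = 1 → f t ∈ C) := by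
  induction n with
  | zero =>
    intro x
    refine ⟨fun _ => x default, continuous_const, fun C _ h _ => h _, fun i => i.elim0, fun i => i.elim0⟩
  | succ n ih =>
    intro x
    obtain ⟨f, hfc, hf, hf0, hf1⟩ := ih (fun ε => x (Fin.cons false ε))
    obtain ⟨g, hgc, hg, hg0, hg1⟩ := ih (fun ε => x (Fin.cons true ε))
    refine ⟨fun t => geo (f (Fin.tail t)) (g (Fin.tail t)) (t 0), ?_, ?_, ?_, ?_⟩
    · have ht : Continuous (fun t : Fin (n+1) → ℝ => Fin.tail t) := by
        unfold Fin.tail; fun_prop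
      exact geo_continuous.comp ((hfc.comp ht).prodMk ((hgc.comp ht).prodMk (continuous_apply 0)))
    · intro C hC h t
      exact hC _ (hf C hC (fun ε => h _) _) _ (hg C hC (fun ε => h _) _) _
    · intro i C hC h t hti
      induction i using Fin.cases with
      | zero =>
        simp only [hti, geo_zero]
        exact hf C hC (fun ε => h _ (by simp)) _
      | succ j =>
        exact hC _ (hf0 j C hC (fun ε he => h _ (by simpa using he)) _ hti) _
          (hg0 j C hC (fun ε he => h _ (by simpa using he)) _ hti) _
    · intro i C hC h t hti
      induction i using Fin.cases with
      | zero =>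
        simp only [hti, geo_one]
        exact hg C hC (fun ε => h _ (by simp)) _
      | succ j =>
        exact hC _ (hf1 j C hC (fun ε he => h _ (by simpa using he)) _ hti) _
          (hg1 j C hC (fun ε he => h _ (by simpa using he)) _ hti) _

/-- circumcenter fixed point -/
lemma exists_center [CompleteSpace X] {C B : Set X} (hC : GConv C) (hCc : IsClosed C)
    (hCn : C.Nonempty) (hBb : Bornology.IsBounded B) (hBn : B.Nonempty) :
    ∃ c ∈ C, ∀ φ : X → X, Isometry φ → (∀ x ∈ C, φ x ∈ C) → (∀ b ∈ B, ∃ b' ∈ B, φ b' = b) →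
      φ c = c := by
  let R : Set ℝ := {ρ | 0 ≤ ρ ∧ ∃ x ∈ C, ∀ b ∈ B, dist x b ≤ ρ}
  have hRn : R.Nonempty := by
    obtain ⟨x, hx⟩ := hCn
    obtain ⟨r, hr⟩ := hBb.subset_closedBall x
    refine ⟨max r 0, le_max_right _ _, x, hx, fun b hb => ?_⟩
    have := hr hb
    rw [Metric.mem_closedBall, dist_comm] at this
    exact this.trans (le_max_left _ _)
  have hRb : BddBelow R := ⟨0, fun ρ h => h.1⟩
  set ρ0 := sInf R with hρ0
  have hρ0n : 0 ≤ ρ0 := le_csInf hRn fun ρ h => h.1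
  have key : ∀ ρ, 0 ≤ ρ → ∀ x ∈ C, ∀ y ∈ C, (∀ b ∈ B, dist x b ≤ ρ) → (∀ b ∈ B, dist y b ≤ ρ) →
      dist x y ^ 2 ≤ 4 * (ρ ^ 2 - ρ0 ^ 2) := by
    intro ρ hρ x hx y hy hxb hyb
    have hm := hC x hx y hy (1/2)
    have hh : (1/2 : ℝ) ∈ Set.Icc (0:ℝ) 1 := by constructor <;> norm_num
    have hb : ∀ b ∈ B, dist (geo x y (1/2)) b ^ 2 ≤ ρ ^ 2 - dist x y ^ 2 / 4 := by
      intro b hb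
      have := cat0_stewart (geo_spec x y) b hh
      rw [dist_comm b x, dist_comm b y, dist_comm b] at this
      have h1 := pow_le_pow_left₀ dist_nonneg (hxb b hb) 2
      have h2 := pow_le_pow_left₀ dist_nonneg (hyb b hb) 2
      linarith
    have hnn : 0 ≤ ρ ^ 2 - dist x y ^ 2 / 4 := by
      obtain ⟨b, hbB⟩ := hBn
      exact (sq_nonneg _).trans (hb b hbB)
    have hmem : Real.sqrt (ρ ^ 2 - dist x y ^ 2 / 4) ∈ R :=
      ⟨Real.sqrt_nonneg _, _, hm, fun b hbB => Real.le_sqrt_of_sq_le (hb b hbB)⟩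
    have := csInf_le hRb hmem
    have h2 := pow_le_pow_left₀ hρ0n this 2
    rw [Real.sq_sqrt hnn] at h2
    linarith
  have hseq : ∀ n : ℕ, ∃ x ∈ C, ∀ b ∈ B, dist x b ≤ ρ0 + 1 / (n + 1) := by
    intro n
    have : ρ0 < ρ0 + 1 / ((n:ℝ) + 1) := by
      have : (0:ℝ) < 1 / ((n:ℝ) + 1) := by positivity
      linarith
    obtain ⟨ρ, hρ, hlt⟩ := exists_lt_of_csInf_lt hRn this
    obtain ⟨x, hx, hb⟩ := hρ.2
    exact ⟨x, hx, fun b hbB => (hb b hbB).trans hlt.le⟩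
  choose x hxC hxB using hseq
  have htend : Filter.Tendsto (fun n : ℕ => Real.sqrt (4 * ((ρ0 + 1 / ((n:ℝ) + 1)) ^ 2 - ρ0 ^ 2))) Filter.atTop (nhds 0) := by
    have h1 : Filter.Tendsto (fun n : ℕ => (1 / ((n:ℝ) + 1))) Filter.atTop (nhds 0) := tendsto_one_div_add_atTop_nhds_zero_nat
    have hc : Continuous (fun s : ℝ => Real.sqrt (4 * ((ρ0 + s) ^ 2 - ρ0 ^ 2))) := by fun_prop
    have := (hc.tendsto 0).comp h1
    simp only [add_zero, sub_self, mul_zero, Real.sqrt_zero] at this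
    exact this
  have hcau : CauchySeq x := by
    refine cauchySeq_of_le_tendsto_0 _ (fun n m N hn hm => ?_) htend
    have hpos : (0:ℝ) < 1 / ((N:ℝ) + 1) := by positivity
    have mono : ∀ k : ℕ, N ≤ k → ∀ b ∈ B, dist (x k) b ≤ ρ0 + 1 / ((N:ℝ) + 1) := by
      intro k hk b hb
      refine (hxB k b hb).trans ?_
      have : (1:ℝ) / ((k:ℝ) + 1) ≤ 1 / ((N:ℝ) + 1) := Nat.one_div_le_one_div hk
      linarith
    exact Real.le_sqrt_of_sq_le (key _ (by linarith) _ (hxC n) _ (hxC m) (mono n hn) (mono m hm))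
  obtain ⟨c, hc⟩ := cauchySeq_tendsto_of_complete hcau
  have hcC : c ∈ C := hCc.mem_of_tendsto hc (Filter.Eventually.of_forall hxC)
  have hcB : ∀ b ∈ B, dist c b ≤ ρ0 := by
    intro b hb
    have h1 : Filter.Tendsto (fun n : ℕ => ρ0 + (1 / ((n:ℝ) + 1))) Filter.atTop (nhds (ρ0 + 0)) :=
      tendsto_const_nhds.add tendsto_one_div_add_atTop_nhds_zero_nat
    rw [add_zero] at h1
    exact le_of_tendsto_of_tendsto' (hc.dist tendsto_const_nhds) h1 (fun n => hxB n b hb)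
  refine ⟨c, hcC, fun φ hφ hφC hφB => ?_⟩
  have h1 : ∀ b ∈ B, dist (φ c) b ≤ ρ0 := by
    intro b hb
    obtain ⟨b', hb', rfl⟩ := hφB b hb
    rw [hφ.dist_eq]; exact hcB b' hb'
  have := key ρ0 hρ0n _ (hφC c hcC) _ hcC h1 hcB
  rw [sub_self, mul_zero] at this
  have := pow_eq_zero_iff (two_ne_zero) |>.1 (le_antisymm this (sq_nonneg _))
  exact dist_eq_zero.1 this

end cat0

/-- The dimension obstruction: `d` pairs of convex sets, disjoint in pairs and otherwise
crossing, cannot exist in dimension less than `d`. -/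
lemma dim_obstruction {X : Type} [MetricSpace X] [CAT0Space X] {d d' : ℕ}
    (hdim : CoveringDimLE X d') (hlt : d' < d) (C : Fin d → Bool → Set X)
    (hconv : ∀ i b, GConv (C i b)) (hclosed : ∀ i b, IsClosed (C i b))
    (hdisj : ∀ i x, x ∈ C i false → x ∈ C i true → False)
    (hcross : ∀ ε : Fin d → Bool, ∃ x, ∀ i, x ∈ C i (ε i)) : False := by
  classical
  choose x hx using hcross
  obtain ⟨f, hfc, -, hf0, hf1⟩ := exists_cube_map d x
  obtain ⟨κ, V, hVo, hVc, hVU, hVn⟩ := hdim (Fin d → Bool) (fun ε => ⋂ i, (C i (ε i))ᶜ)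
    (fun ε => isOpen_iInter_of_finite fun i => (hclosed i _).isOpen_compl)
    (by
      rw [Set.eq_univ_iff_forall]
      intro y
      rw [Set.mem_iUnion]
      refine ⟨fun i => decide (y ∈ C i false), Set.mem_iInter.2 fun i => ?_⟩
      by_cases h : y ∈ C i false
      · simp only [h, decide_true]
        exact fun h' => hdisj i y h h'
      · simpa [h] using h)
  choose u hu using hVU
  obtain ⟨δ, hδ, hleb⟩ := lebesgue_number_lemma_of_metric (s := Set.Icc (0 : Fin d → ℝ) 1)
    (c := fun j => f ⁻¹' V j) isCompact_Icc (fun j => (hVo j).preimage hfc)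
    (by
      intro t _
      have : f t ∈ ⋃ j, V j := by rw [hVc]; trivial
      simpa using this)
  obtain ⟨M, hM⟩ := exists_nat_one_div_lt hδ
  set N := M + 1 with hNdef
  have hN : 0 < N := Nat.succ_pos _
  have hNr : (0:ℝ) < N := by exact_mod_cast hN
  let pt : (Fin d → ℕ) → Fin d → ℝ := fun v i => (v i : ℝ) / N
  have hpt : ∀ v : Fin d → ℕ, (∀ i, v i ≤ N) → pt v ∈ Set.Icc (0 : Fin d → ℝ) 1 := by
    intro v hv
    refine ⟨fun i => ?_, fun i => ?_⟩
    · simp only [pt, Pi.zero_apply]; positivity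
    · simp only [pt, Pi.one_apply]
      rw [div_le_one hNr]; exact_mod_cast hv i
  have hj : ∀ v : Fin d → ℕ, ∃ j, (∀ i, v i ≤ N) → Metric.ball (pt v) δ ⊆ f ⁻¹' V j := by
    intro v
    by_cases hv : ∀ i, v i ≤ N
    · obtain ⟨j, hj⟩ := hleb _ (hpt v hv)
      exact ⟨j, fun _ => hj⟩
    · obtain ⟨j, -⟩ := hleb 0 ⟨le_rfl, zero_le_one⟩
      exact ⟨j, fun h => absurd h hv⟩
  choose J hJ using hj
  let lab : (Fin d → Bool) → ℕ := fun ε => Finset.univ.sup (fun i : Fin d => if ε i = true then (i:ℕ) + 1 else 0)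
  have hmem : ∀ v, (∀ i, v i ≤ N) → ∀ i, f (pt v) ∉ C i (u (J v) i) := by
    intro v hv i
    have h1 := hJ v hv (Metric.mem_ball_self hδ)
    have h2 := hu _ h1
    exact Set.mem_iInter.1 h2 i
  have hcount := kuhn_count_odd d N hN (fun v => lab (u (J v))) ?_ ?_ ?_
  · have : ∃ a ∈ Fintype.piFinset (fun _ : Fin d => Finset.range N), ∃ σ : Equiv.Perm (Fin d),
        KFull d (fun k => lab (u (J (kuhnPath a σ k)))) := by
      by_contra hcon
      push Not at hcon
      have h0 : kuhnCount d N (fun v => lab (u (J v))) = 0 := by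
        unfold kuhnCount
        refine Finset.sum_eq_zero fun a ha => Finset.sum_eq_zero fun σ _ => ?_
        rw [if_neg (hcon a ha σ)]
      rw [h0] at hcount
      exact absurd hcount (by decide)
    obtain ⟨a, ha, σ, hfull⟩ := this
    have ha' : ∀ i, a i < N := by simpa using ha
    obtain ⟨hfin, hcard⟩ := hVn (f (pt a))
    have hsub : ∀ k : Fin (d+1), f (pt a) ∈ V (J (kuhnPath a σ k)) := by
      intro k
      apply hJ _ (kuhnPath_le ha' σ k)
      rw [Metric.mem_ball]
      refine lt_of_le_of_lt ?_ hM
      rw [dist_pi_le_iff (by positivity)]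
      intro i
      rw [Real.dist_eq]
      simp only [pt, kuhnPath]
      have hc : ((M:ℝ) + 1) = N := by simp [hNdef]
      rw [hc, ← sub_div, abs_div, abs_of_pos hNr]
      gcongr
      split_ifs <;> simp
    choose kk hkk using hfull
    have hinj : d + 1 ≤ {j | f (pt a) ∈ V j}.ncard := by
      have hle : (((Finset.univ : Finset (Fin (d+1))).image (fun k : Fin (d+1) => J (kuhnPath a σ k)) : Finset κ) : Set κ) ⊆ {j | f (pt a) ∈ V j} := by
        intro j hj
        simp only [Finset.coe_image, Finset.coe_univ, Set.image_univ, Set.mem_range] at hj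
        obtain ⟨k, rfl⟩ := hj
        exact hsub k
      have h1 := Set.ncard_le_ncard hle hfin
      rw [Set.ncard_coe_finset] at h1
      refine le_trans ?_ h1
      have h2 : Finset.range (d+1) ⊆ ((Finset.univ : Finset (Fin (d+1))).image (fun k : Fin (d+1) => J (kuhnPath a σ k))).image (fun j => lab (u j)) := by
        intro m hm
        rw [Finset.mem_range] at hm
        rw [Finset.image_image, Finset.mem_image]
        exact ⟨kk m (by omega), Finset.mem_univ _, hkk m (by omega)⟩
      have h3 := Finset.card_le_card h2
      rw [Finset.card_range] at h3
      exact h3.trans Finset.card_image_le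
    omega
  · intro v hv
    refine Finset.sup_le fun i _ => ?_
    split_ifs <;> omega
  · intro v hv i hi hlab
    have hft : f (pt v) ∈ C i true := by
      refine hf1 i _ (hconv i true) (fun ε he => ?_) _ ?_
      · have := hx ε i; rwa [he] at this
      · simp only [pt, hi]; field_simp
    have hui : u (J v) i = false := by
      have := hmem v hv i
      by_contra h
      rw [Bool.not_eq_false] at h
      rw [h] at this; exact this hft
    obtain ⟨i', -, hi'⟩ := Finset.exists_mem_eq_sup (Finset.univ : Finset (Fin d)) ⟨i, Finset.mem_univ _⟩
      (fun i : Fin d => if u (J v) i = true then (i:ℕ) + 1 else 0)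
    simp only [lab] at hlab
    rw [hi'] at hlab
    split_ifs at hlab with hh
    · have : i' = i := Fin.ext (by omega)
      rw [this, hui] at hh
      exact absurd hh (by simp)
  · intro v hv i hi
    have hft : f (pt v) ∈ C i false := by
      refine hf0 i _ (hconv i false) (fun ε he => ?_) _ ?_
      · have := hx ε i; rwa [he] at this
      · simp only [pt, hi]; simp
    have hui : u (J v) i = true := by
      have := hmem v hv i
      by_contra h
      rw [Bool.not_eq_true] at h
      rw [h] at this; exact this hft
    have := Finset.le_sup (f := fun i : Fin d => if u (J v) i = true then (i:ℕ) + 1 else 0) (Finset.mem_univ i)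
    simp only [hui, if_true] at this
    exact this

section groups
variable {G : Type*} [Group G] {X : Type*} [MetricSpace X] [MulAction G X]

/-- common fixed points of a set of group elements -/
def FixS (X : Type*) [MulAction G X] (A : Set G) : Set X := {x | ∀ g ∈ A, g • x = x}

lemma FixS_closed (hiso : ∀ g : G, Isometry (fun x : X => g • x)) (A : Set G) :
    IsClosed (FixS X A) := by
  have : FixS X A = ⋂ g ∈ A, {x | g • x = x} := by ext; simp [FixS]
  rw [this]
  exact isClosed_biInter fun g _ => isClosed_eq (hiso g).continuous continuous_id

lemma FixS_conv [CAT0Space X] (hiso : ∀ g : G, Isometry (fun x : X => g • x)) (A : Set G) :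
    GConv (FixS X A) := by
  intro x hx y hy t g hg
  rw [geo_proj]
  have ht := (Set.projIcc (0:ℝ) 1 zero_le_one t).2
  refine geo_unique ht ?_ ?_
  · have := (hiso g).dist_eq x (geo x y (Set.projIcc (0:ℝ) 1 zero_le_one t))
    simp only [hx g hg] at this
    rw [this, dist_left_geo x y ht]
  · have := (hiso g).dist_eq y (geo x y (Set.projIcc (0:ℝ) 1 zero_le_one t))
    simp only [hy g hg] at this
    rw [this, dist_right_geo x y ht]

lemma FixS_closure {A : Set G} {x : X} (hx : x ∈ FixS X A) {g : G} (hg : g ∈ Subgroup.closure A) :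
    g • x = x := by
  have : Subgroup.closure A ≤ MulAction.stabilizer G x :=
    (Subgroup.closure_le _).2 fun g hg => hx g hg
  exact this hg

/-- a subgroup with a bounded orbit, preserving a closed convex set, fixes a point in it -/
lemma fixed_in_convex [CAT0Space X] [CompleteSpace X]
    (hiso : ∀ g : G, Isometry (fun x : X => g • x)) (H : Subgroup G) {C : Set X}
    (hC : GConv C) (hCc : IsClosed C) (hCn : C.Nonempty) (hinv : ∀ g ∈ H, ∀ x ∈ C, g • x ∈ C)
    (y : X) (hb : Bornology.IsBounded {z | ∃ g ∈ H, g • y = z}) :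
    ∃ c ∈ C, ∀ g ∈ H, g • c = c := by
  obtain ⟨c, hc, h⟩ := exists_center hC hCc hCn hb ⟨y, 1, H.one_mem, one_smul _ _⟩
  refine ⟨c, hc, fun g hg => h _ (hiso g) (hinv g hg) ?_⟩
  rintro b ⟨k, hk, rfl⟩
  exact ⟨(g⁻¹ * k) • y, ⟨g⁻¹ * k, H.mul_mem (H.inv_mem hg) hk, rfl⟩, by simp [mul_smul]⟩

lemma fix_finOrder [CAT0Space X] [CompleteSpace X] [Nonempty X]
    (hiso : ∀ g : G, Isometry (fun x : X => g • x)) (g : G) (hg : IsOfFinOrder g) :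
    (FixS X {g}).Nonempty := by
  obtain ⟨y⟩ := ‹Nonempty X›
  obtain ⟨c, -, h⟩ := fixed_in_convex hiso (Subgroup.zpowers g) (C := Set.univ)
    (fun _ _ _ _ _ => trivial) isClosed_univ ⟨y, trivial⟩ (fun _ _ _ _ => trivial) y (by
      apply Set.Finite.isBounded
      have hfin : (Subgroup.zpowers g : Set G).Finite := by
        exact finite_zpowers.2 hg
      refine (hfin.image (fun k => k • y)).subset ?_
      rintro z ⟨k, hk, rfl⟩
      exact ⟨k, hk, rfl⟩)
  exact ⟨c, by rintro k rfl; exact h k (Subgroup.mem_zpowers k)⟩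

lemma fix_commuting [CAT0Space X] [CompleteSpace X] [Nonempty X]
    (hiso : ∀ g : G, Isometry (fun x : X => g • x)) {ι : Type*} (D : ι → Set G)
    (hcomm : ∀ i j, i ≠ j → ∀ g ∈ D i, ∀ h ∈ D j, g * h = h * g)
    (hne : ∀ i, (FixS X (D i)).Nonempty) (s : Finset ι) :
    (FixS X (⋃ i ∈ s, D i)).Nonempty := by
  classical
  induction s using Finset.induction_on with
  | empty => obtain ⟨y⟩ := ‹Nonempty X›; exact ⟨y, by intro g hg; simp at hg⟩
  | insert i s hi ih =>
    obtain ⟨y, hy⟩ := hne i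
    obtain ⟨c, hc, hfix⟩ := fixed_in_convex hiso (Subgroup.closure (D i)) (FixS_conv hiso _)
      (FixS_closed hiso _) ih (by
        intro g hg x hx k hk
        have hgk : g ∈ Subgroup.centralizer {k} := by
          refine (Subgroup.closure_le _).2 ?_ hg
          intro g' hg'
          simp only [Set.mem_iUnion] at hk
          obtain ⟨j, hj, hkj⟩ := hk
          have := hcomm i j (by rintro rfl; exact hi hj) g' hg' k hkj
          simp only [SetLike.mem_coe, Subgroup.mem_centralizer_iff, Set.mem_singleton_iff, forall_eq]
          exact this.symm
        rw [Subgroup.mem_centralizer_iff] at hgk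
        have := hgk k rfl
        rw [← mul_smul, this, mul_smul, hx k hk]) y (by
        refine (Bornology.isBounded_singleton (x := y)).subset ?_
        rintro z ⟨g, hg, rfl⟩
        exact FixS_closure hy hg)
    refine ⟨c, fun g hg => ?_⟩
    simp only [Finset.mem_insert, Set.iUnion_iUnion_eq_or_left, Set.mem_union] at hg
    rcases hg with hg | hg
    · exact hfix g (Subgroup.subset_closure hg)
    · exact hc g hg

end groups

/-- The bootstrap argument. -/
lemma bootstrap {G : Type*} [Group G] {X : Type} [MetricSpace X] [MulAction G X] [CAT0Space X]
    [CompleteSpace X] [Nonempty X] (hiso : ∀ g : G, Isometry (fun x : X => g • x)) {d d' : ℕ}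
    (hdim : CoveringDimLE X d') (hlt : d' < d) (A : Fin d → Finset G)
    (hcomm : ∀ i j, i ≠ j → ∀ g ∈ A i, ∀ h ∈ A j, g * h = h * g)
    (hfin : ∀ i, ∀ g ∈ A i, IsOfFinOrder g) :
    ∃ i, (FixS X (A i : Set G)).Nonempty := by
  classical
  by_contra hcon
  push Not at hcon
  have hmin : ∀ i, ∃ B : Finset G, ∃ s ∈ B, B ⊆ A i ∧ FixS X (B : Set G) = ∅ ∧
      (FixS X ((B.erase s : Finset G) : Set G)).Nonempty := by
    intro i
    obtain ⟨B, hB⟩ := Finset.exists_minimal (s := (A i).powerset.filter (fun B : Finset G => FixS X (B : Set G) = ∅))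
      ⟨A i, by simp [hcon i]⟩
    have hBm := hB.1
    beta_reduce at hBm
    rw [Finset.mem_filter, Finset.mem_powerset] at hBm
    have hBne : B.Nonempty := by
      rw [Finset.nonempty_iff_ne_empty]
      rintro rfl
      obtain ⟨y⟩ := ‹Nonempty X›
      have : y ∈ FixS X ((∅ : Finset G) : Set G) := by intro g hg; simp at hg
      rw [hBm.2] at this; exact this
    obtain ⟨s, hs⟩ := hBne
    refine ⟨B, s, hs, hBm.1, hBm.2, ?_⟩
    by_contra hne
    rw [Set.not_nonempty_iff_eq_empty] at hne
    have := hB.2 (y := B.erase s) (by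
      beta_reduce
      rw [Finset.mem_filter, Finset.mem_powerset]
      exact ⟨(Finset.erase_subset _ _).trans hBm.1, hne⟩) (Finset.erase_subset _ _)
    exact Finset.notMem_erase s B (this hs)
  choose B s hsB hBA hBe hBs using hmin
  let D : Fin d → Bool → Set G := fun i b => if b then ((B i).erase (s i) : Finset G) else {s i}
  have hDA : ∀ i b, ∀ g ∈ D i b, g ∈ A i := by
    intro i b g hg
    cases b with
    | false =>
      simp only [D, Bool.false_eq_true, if_false, Set.mem_singleton_iff] at hg
      rw [hg]; exact hBA i (hsB i)
    | true =>
      simp only [D, if_true, Finset.mem_coe] at hg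
      exact hBA i (Finset.mem_of_mem_erase hg)
  refine dim_obstruction hdim hlt (fun i b => FixS X (D i b)) (fun i b => FixS_conv hiso _)
    (fun i b => FixS_closed hiso _) ?_ ?_
  · intro i x h0 h1
    have : x ∈ FixS X (B i : Set G) := by
      intro g hg
      by_cases hgs : g = s i
      · exact h0 g (by simp [D, hgs])
      · exact h1 g (by simpa [D, hgs] using hg)
    rw [hBe i] at this; exact this
  · intro ε
    obtain ⟨x, hx⟩ := fix_commuting (X := X) hiso (fun i => D i (ε i))
      (fun i j hij g hg h hh => hcomm i j hij g (hDA _ _ g hg) h (hDA _ _ h hh)) (by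
        intro i
        cases h : ε i with
        | false =>
          simp only [D, Bool.false_eq_true, if_false]
          exact fix_finOrder hiso _ (hfin i _ (hBA i (hsB i)))
        | true =>
          simp only [D, if_true]
          exact hBs i) Finset.univ
    exact ⟨x, fun i g hg => hx g (by simp only [Set.mem_iUnion]; exact ⟨i, Finset.mem_univ _, hg⟩)⟩

/-- If Γ is generated by finitely many elements of finite order, then the wreath product
Γ ≀ C_d has a global fixed point whenever it acts by isometries on a complete CAT(0) space
of dimension less than d. -/
theorem wreath_fixed_point (Γ : Type) [Group Γ]
    (hgen : ∃ T : Finset Γ, (∀ g ∈ T, IsOfFinOrder g) ∧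
      Subgroup.closure (T : Set Γ) = ⊤)
    {d : ℕ} {X : Type} [MetricSpace X] [CompleteSpace X] [CAT0Space X] [Nonempty X]
    [MulAction (WreathCd Γ d) X]
    (hiso : ∀ g : WreathCd Γ d, Isometry (fun x : X => g • x))
    {d' : ℕ} (hdim : CoveringDimLE X d') (hlt : d' < d) :
    ∃ x : X, ∀ g : WreathCd Γ d, g • x = x := by
  classical
  obtain ⟨T, hT, hTc⟩ := hgen
  haveI : NeZero d := ⟨by omega⟩
  let inl : (ZMod d → Γ) →* WreathCd Γ d :=
    (SemidirectProduct.inl : (ZMod d → Γ) →* (ZMod d → Γ) ⋊[shiftHom Γ d] Multiplicative (ZMod d))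
  let inr : Multiplicative (ZMod d) →* WreathCd Γ d :=
    (SemidirectProduct.inr : Multiplicative (ZMod d) →* (ZMod d → Γ) ⋊[shiftHom Γ d] Multiplicative (ZMod d))
  let emb : ZMod d → Γ →* WreathCd Γ d := fun s => inl.comp (MonoidHom.mulSingle (fun _ => Γ) s)
  have hconj : ∀ (t : Multiplicative (ZMod d)) (n : ZMod d → Γ),
      inr t * inl n * (inr t)⁻¹ = inl (shiftHom Γ d t n) := by
    intro t n
    rw [← map_inv]
    exact (SemidirectProduct.inl_aut (φ := shiftHom Γ d) t n).symm
  have hdecomp : ∀ g : WreathCd Γ d, ∃ n t, g = inl n * inr t := by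
    intro g
    exact ⟨_, _, (SemidirectProduct.inl_left_mul_inr_right
      (φ := shiftHom Γ d) g).symm⟩
  have hconj' : ∀ (s t : ZMod d) (g : Γ),
      inr (Multiplicative.ofAdd t) * emb s g * (inr (Multiplicative.ofAdd t))⁻¹ = emb (s + t) g := by
    intro s t g
    have := hconj (Multiplicative.ofAdd t) (Pi.mulSingle s g)
    refine this.trans ?_
    change inl _ = inl (Pi.mulSingle (s + t) g)
    congr 1
    funext z
    change (Pi.mulSingle s g : ZMod d → Γ) (z - t) = (Pi.mulSingle (s + t) g : ZMod d → Γ) z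
    by_cases h : z = s + t
    · subst h; simp
    · rw [Pi.mulSingle_eq_of_ne h, Pi.mulSingle_eq_of_ne]
      intro h'; apply h; rw [← h']; ring
  have hcommE : ∀ s t : ZMod d, s ≠ t → ∀ g h : Γ, emb s g * emb t h = emb t h * emb s g := by
    intro s t hst g h
    change inl (Pi.mulSingle s g) * inl (Pi.mulSingle t h) = inl (Pi.mulSingle t h) * inl (Pi.mulSingle s g)
    rw [← map_mul, ← map_mul]
    congr 1
    exact Pi.mulSingle_commute (f := fun _ : ZMod d => Γ) hst g h
  have eZ : Fin d ≃ ZMod d := (ZMod.finEquiv d).toEquiv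
  obtain ⟨i0, x0, hx0⟩ := bootstrap hiso hdim hlt (fun i => T.image (emb (eZ i)))
    (by
      intro i j hij g hg h hh
      rw [Finset.mem_image] at hg hh
      obtain ⟨g, -, rfl⟩ := hg
      obtain ⟨h, -, rfl⟩ := hh
      exact hcommE _ _ (fun h => hij (eZ.injective h)) g h)
    (by
      intro i g hg
      rw [Finset.mem_image] at hg
      obtain ⟨g, hgT, rfl⟩ := hg
      exact (emb (eZ i)).isOfFinOrder (hT g hgT))
  have hall : ∀ s : ZMod d, (FixS X (emb s '' (T : Set Γ))).Nonempty := by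
    intro s
    refine ⟨inr (Multiplicative.ofAdd (s - eZ i0)) • x0, ?_⟩
    rintro _ ⟨g, hg, rfl⟩
    have h1 := hconj' (eZ i0) (s - eZ i0) g
    rw [add_sub_cancel] at h1
    rw [← h1, ← mul_smul, inv_mul_cancel_right, mul_smul, hx0]
    exact Finset.mem_coe.2 (Finset.mem_image_of_mem _ hg)
  obtain ⟨x, hx⟩ := fix_commuting (X := X) hiso (fun s => emb s '' (T : Set Γ))
    (by
      rintro s t hst _ ⟨g, -, rfl⟩ _ ⟨h, -, rfl⟩
      exact hcommE s t hst g h) hall Finset.univ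
  have hbase : ∀ n : ZMod d → Γ, inl n • x = x := by
    intro n
    have hn : n ∈ (MulAction.stabilizer (WreathCd Γ d) x).comap inl := by
      refine Subgroup.pi_mem_of_mulSingle_mem n fun s => ?_
      have : (⊤ : Subgroup Γ) ≤ (MulAction.stabilizer (WreathCd Γ d) x).comap (emb s) := by
        rw [← hTc, Subgroup.closure_le]
        intro g hg
        refine hx _ ?_
        simp only [Set.mem_iUnion]
        exact ⟨s, Finset.mem_univ _, g, hg, rfl⟩
      exact this (Subgroup.mem_top (n s))
    exact hn
  obtain ⟨c, -, hc⟩ := fixed_in_convex hiso (⊤ : Subgroup (WreathCd Γ d)) (C := Set.univ)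
    (fun _ _ _ _ _ => trivial) isClosed_univ ⟨x, trivial⟩ (fun _ _ _ _ => trivial) x (by
      apply Set.Finite.isBounded
      haveI : Finite (Multiplicative (ZMod d)) := inferInstanceAs (Finite (ZMod d))
      refine (Set.finite_range (fun t : Multiplicative (ZMod d) => inr t • x)).subset ?_
      rintro z ⟨g, -, rfl⟩
      obtain ⟨n, t, hnt⟩ := hdecomp g⁻¹
      refine ⟨t⁻¹, ?_⟩
      have : g = inr t⁻¹ * inl n⁻¹ := by
        rw [map_inv, map_inv, ← mul_inv_rev, ← hnt, inv_inv]
      rw [this, mul_smul, hbase])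
  exact ⟨c, fun g => hc g (Subgroup.mem_top g)⟩
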